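/- arXiv:2007.12618 — 2 statements merged into one kernel-verified Lean document; each statement's English description precedes it below -/
import Mathlib

section
/- Theorem 1 (Gaptron mistake bound for the logistic loss, full information): Let K ≥ 2, d ≥ 1, X > 0, D > 0 and η = ln(2)/(2KX²). Given x_1,…,x_T ∈ ℝ^d with ‖x_t‖ ≤ X and y_1,…,y_T ∈ {1,…,K}, define W_1 = 0 and W_{t+1} = Π_D(W_t − η g_t), where p̃_t(k) = σ(W_t,x_t,k) and g_t = (1/ln 2)(p̃_t − e_{y_t}) ⊗ x_t. Let y_t⋆ be any label maximizing k ↦ ⟨W_t^k, x_t⟩ (equivalently, maximizing p̃_t(k)), let p_t⋆ = max_k p̃_t(k), and set a_t = 1 − p_t⋆ if p_t⋆ ≥ 1/2 and a_t = 1 otherwise. Then for every U ∈ ℝ^{K×d} with ‖U‖ ≤ D: Σ_{t=1}^T [(1 − a_t)·1[y_t⋆ ≠ y_t] + a_t·(K−1)/K] ≤ Σ_{t=1}^T (−log₂ σ(U,x_t,y_t)) + KX²‖U‖²/ln 2. -/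
open scoped RealInnerProductSpace BigOperators

/-- Frobenius norm of a `K × d` matrix given by its rows. -/
noncomputable def frob {K d : ℕ} (W : Fin K → EuclideanSpace ℝ (Fin d)) : ℝ :=
  Real.sqrt (∑ k, ‖W k‖ ^ 2)

/-- Euclidean (Frobenius) projection onto the ball of radius `D`. -/
noncomputable def projM {K d : ℕ} (D : ℝ) (V : Fin K → EuclideanSpace ℝ (Fin d)) :
    Fin K → EuclideanSpace ℝ (Fin d) :=
  if frob V ≤ D then V else fun k => (D / frob V) • V k

/-- Softmax probabilities `σ(W, x, k)`. -/
noncomputable def softmax {K d : ℕ} (W : Fin K → EuclideanSpace ℝ (Fin d))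
    (x : EuclideanSpace ℝ (Fin d)) (k : Fin K) : ℝ :=
  Real.exp ⟪W k, x⟫ / ∑ j, Real.exp ⟪W j, x⟫


lemma aux_pair {K : ℕ} (p : Fin K → ℝ) (hp : ∀ k, 0 ≤ p k) (hs : ∑ k, p k = 1)
    {i j : Fin K} (h : i ≠ j) : p i + p j ≤ 1 := by
  rw [← hs, ← Finset.sum_pair h]
  exact Finset.sum_le_sum_of_subset_of_nonneg (Finset.subset_univ _) (fun k _ _ => hp k)

lemma aux_sq {K : ℕ} (p : Fin K → ℝ) (hp : ∀ k, 0 ≤ p k) (hs : ∑ k, p k = 1) (y : Fin K) :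
    ∑ k, (p k - if k = y then 1 else 0) ^ 2 ≤ 2 * (1 - p y) ^ 2 := by
  have h1 : ∑ k, (p k - if k = y then 1 else 0) ^ 2 ≤
      ∑ k, ((1 - p y) * p k + if k = y then (1 - p y) ^ 2 - (1 - p y) * p y else 0) := by
    refine Finset.sum_le_sum fun k _ => ?_
    by_cases h : k = y
    · subst h; simp only [if_true]; nlinarith
    · simp only [h, if_false]
      have := aux_pair p hp hs h
      nlinarith [hp k]
  refine h1.trans ?_
  rw [Finset.sum_add_distrib, ← Finset.mul_sum, hs, Finset.sum_ite_eq' Finset.univ y]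
  simp only [Finset.mem_univ, if_true]
  nlinarith

lemma aux_scalar (K q P M L N : ℝ) (hK : 2 ≤ K) (hL : L = Real.log 2) (hq : 0 < q)
    (hN : N ≤ 2 * (1 - q) ^ 2)
    (h : (1 / 2 ≤ P ∧ q = P ∧ P ≤ 1 ∧ M = (1 - P) * ((K - 1) / K)) ∨
      (1 / 2 ≤ P ∧ q + P ≤ 1 ∧ M = P + (1 - P) * ((K - 1) / K)) ∨
      (P < 1 / 2 ∧ q ≤ P ∧ M = (K - 1) / K)) :
    M + N / (4 * K * L) ≤ - Real.log q / L := by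
  have hL1 : 0.69 < L := by rw [hL]; have := Real.log_two_gt_d9; linarith
  have hL2 : L < 0.7 := by rw [hL]; have := Real.log_two_lt_d9; linarith
  have hl1 : 1 - q ≤ - Real.log q := by
    have := Real.log_le_sub_one_of_pos hq; linarith
  have hl2 : L + 1 - 2 * q ≤ - Real.log q := by
    have := Real.log_le_sub_one_of_pos (show 0 < 2 * q by linarith)
    rw [Real.log_mul (by norm_num) hq.ne', ← hL] at this; linarith
  have hK0 : 0 < K := by linarith
  have hL0 : 0 < L := by linarith
  have key : 4 * K * L * M + N ≤ 4 * K * (- Real.log q) → M + N / (4 * K * L) ≤ - Real.log q / L := by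
    intro h
    have e : M + N / (4 * K * L) = (4 * K * L * M + N) / (4 * K * L) := by field_simp
    rw [e, div_le_div_iff₀ (by positivity) hL0]
    nlinarith
  apply key
  rcases h with ⟨hP, rfl, hP1, rfl⟩ | ⟨hP, hqP, rfl⟩ | ⟨hP, hqP, rfl⟩
  · have e : 4 * K * L * ((1 - q) * ((K - 1) / K)) = 4 * L * (1 - q) * (K - 1) := by
      field_simp
    rw [e]
    have h1 : 4 * K * (1 - q) ≤ 4 * K * (- Real.log q) := by gcongr
    have h2 : 4 * L * (1 - q) * (K - 1) ≤ 4 * 0.7 * (1 - q) * (K - 1) := by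
      have : 0 ≤ 1 - q := by linarith
      have : 0 ≤ K - 1 := by linarith
      gcongr
    nlinarith [mul_nonneg (sub_nonneg.2 hP1) (sub_nonneg.2 hK), mul_nonneg (sub_nonneg.2 hP1) (sub_nonneg.2 hP)]
  · have e : 4 * K * L * (P + (1 - P) * ((K - 1) / K)) = 4 * L * (K - (1 - P)) := by
      field_simp; ring
    rw [e]
    have h1 : 4 * K * (L + 1 - 2 * q) ≤ 4 * K * (- Real.log q) := by gcongr
    have h2 : L * q ≤ L * (1 - P) := by gcongr; linarith
    have h3 : 0.69 * q ≤ L * q := by gcongr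
    have h4 : 0 ≤ (K - 2) * (1 - 2 * q) := mul_nonneg (by linarith) (by linarith)
    nlinarith [mul_nonneg hq.le (show 0 ≤ 1 / 2 - q by linarith)]
  · have e : 4 * K * L * ((K - 1) / K) = 4 * L * (K - 1) := by
      field_simp
    rw [e]
    have h1 : 4 * K * (L + 1 - 2 * q) ≤ 4 * K * (- Real.log q) := by gcongr
    have h4 : 0 ≤ K * (1 - 2 * q) := mul_nonneg (by linarith) (by linarith)
    nlinarith

lemma aux_convex {K : ℕ} (hK : 2 ≤ K) (u w : Fin K → ℝ) (y : Fin K) :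
    - Real.log (Real.exp (w y) / ∑ j, Real.exp (w j)) +
      ∑ k, (Real.exp (w k) / (∑ j, Real.exp (w j)) - if k = y then 1 else 0) * (u k - w k)
      ≤ - Real.log (Real.exp (u y) / ∑ j, Real.exp (u j)) := by
  haveI : Nonempty (Fin K) := ⟨y⟩
  have hw : 0 < ∑ j, Real.exp (w j) :=
    Finset.sum_pos (fun j _ => Real.exp_pos _) Finset.univ_nonempty
  have hu : 0 < ∑ j, Real.exp (u j) :=
    Finset.sum_pos (fun j _ => Real.exp_pos _) Finset.univ_nonempty
  rw [Real.log_div (Real.exp_pos _).ne' hw.ne', Real.log_div (Real.exp_pos _).ne' hu.ne',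
    Real.log_exp, Real.log_exp]
  have e : ∑ k, (Real.exp (w k) / (∑ j, Real.exp (w j)) - if k = y then 1 else 0) * (u k - w k)
      = ∑ k, Real.exp (w k) / (∑ j, Real.exp (w j)) * (u k - w k) - (u y - w y) := by
    simp only [sub_mul, Finset.sum_sub_distrib, ite_mul, one_mul, zero_mul]
    rw [Finset.sum_ite_eq' Finset.univ y]; simp
  rw [e]
  set S := ∑ j, Real.exp (w j) with hS
  have J := convexOn_exp.map_sum_le (t := Finset.univ) (w := fun k => Real.exp (w k) / S)
    (p := fun k => u k - w k) (fun i _ => by positivity)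
    (by rw [← Finset.sum_div]; exact div_self hw.ne') (fun _ _ => Set.mem_univ _)
  simp only [smul_eq_mul] at J
  have e2 : ∑ k, Real.exp (w k) / S * Real.exp (u k - w k) = (∑ k, Real.exp (u k)) / S := by
    rw [Finset.sum_div]
    refine Finset.sum_congr rfl fun k _ => ?_
    rw [Real.exp_sub]; field_simp
  rw [e2] at J
  have := (Real.le_log_iff_exp_le (by positivity)).2 J
  rw [Real.log_div hu.ne' hw.ne'] at this
  linarith

lemma frob_sq {K d : ℕ} (V : Fin K → EuclideanSpace ℝ (Fin d)) :
    frob V ^ 2 = ∑ k, ‖V k‖ ^ 2 := Real.sq_sqrt (Finset.sum_nonneg fun _ _ => sq_nonneg _)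

lemma aux_expand {K d : ℕ} (c : ℝ) (V U : Fin K → EuclideanSpace ℝ (Fin d)) :
    ∑ k, ‖c • V k - U k‖ ^ 2 = c ^ 2 * frob V ^ 2 - 2 * c * ∑ k, ⟪V k, U k⟫ + frob U ^ 2 := by
  rw [frob_sq, frob_sq, Finset.mul_sum, Finset.mul_sum, ← Finset.sum_sub_distrib,
    ← Finset.sum_add_distrib]
  refine Finset.sum_congr rfl fun k _ => ?_
  rw [norm_sub_sq_real, norm_smul, inner_smul_left, mul_pow, Real.norm_eq_abs, sq_abs]
  simp; ring

lemma aux_proj {K d : ℕ} (D : ℝ) (hD : 0 < D) (V U : Fin K → EuclideanSpace ℝ (Fin d))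
    (hU : frob U ≤ D) : ∑ k, ‖projM D V k - U k‖ ^ 2 ≤ ∑ k, ‖V k - U k‖ ^ 2 := by
  unfold projM
  split_ifs with h
  · exact le_rfl
  · push Not at h
    have e1 := aux_expand 1 V U
    have e2 := aux_expand (D / frob V) V U
    have h0 : 0 ≤ ∑ k, ‖(D / frob V) • V k - U k‖ ^ 2 := Finset.sum_nonneg fun _ _ => sq_nonneg _
    simp only [one_smul] at e1
    have hn : 0 < frob V := hD.trans h
    have hU2 : frob U ^ 2 ≤ D ^ 2 := pow_le_pow_left₀ (Real.sqrt_nonneg _) hU 2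
    rw [e1, e2]
    rw [e2] at h0
    generalize (∑ k, ⟪V k, U k⟫) = I at *
    set n := frob V
    have hc : D = (D / n) * n := by field_simp
    set c := D / n
    have hc0 : 0 < c := div_pos hD hn
    have hc1 : c < 1 := (div_lt_one hn).2 h
    have hI : I ≤ c * n ^ 2 := by
      have : c * I ≤ c * (c * n ^ 2) := by rw [hc] at hU2; nlinarith
      exact le_of_mul_le_mul_left this hc0
    have hn2 : 0 < n ^ 2 := by positivity
    nlinarith [mul_nonneg (sub_nonneg.2 hc1.le) (sub_nonneg.2 hI),
      mul_nonneg (mul_nonneg (sub_nonneg.2 hc1.le) (sub_nonneg.2 hc1.le)) hn2.le]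

lemma aux_step {K d : ℕ} (hK : 2 ≤ K) (X D : ℝ) (hX : 0 < X) (hD : 0 < D)
    (η : ℝ) (hη : η = Real.log 2 / (2 * K * X ^ 2))
    (x : EuclideanSpace ℝ (Fin d)) (hx : ‖x‖ ≤ X) (y : Fin K)
    (W W' g : Fin K → EuclideanSpace ℝ (Fin d))
    (hg : g = fun k => ((1 / Real.log 2) * (softmax W x k - if k = y then 1 else 0)) • x)
    (hW' : W' = projM D (fun k => W k - η • g k))
    (s : Fin K) (hs : ∀ k, ⟪W k, x⟫ ≤ ⟪W s, x⟫)
    (P : ℝ) (hP : P = ⨆ k, softmax W x k)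
    (a : ℝ) (ha : a = if (1 : ℝ) / 2 ≤ P then 1 - P else 1)
    (U : Fin K → EuclideanSpace ℝ (Fin d)) (hU : frob U ≤ D) :
    (1 - a) * (if s ≠ y then (1 : ℝ) else 0) + a * (((K : ℝ) - 1) / K)
      ≤ -(Real.logb 2 (softmax U x y)) + K * X ^ 2 / Real.log 2 *
        (∑ k, ‖W k - U k‖ ^ 2 - ∑ k, ‖W' k - U k‖ ^ 2) := by
  haveI : Nonempty (Fin K) := ⟨y⟩
  have hL : 0 < Real.log 2 := Real.log_pos (by norm_num)
  have hK2 : (2 : ℝ) ≤ K := by exact_mod_cast hK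
  have hS : 0 < ∑ j, Real.exp ⟪W j, x⟫ :=
    Finset.sum_pos (fun j _ => Real.exp_pos _) Finset.univ_nonempty
  have hp0 : ∀ k, 0 < softmax W x k := fun k => div_pos (Real.exp_pos _) hS
  have hp1 : ∑ k, softmax W x k = 1 := by
    unfold softmax; rw [← Finset.sum_div]; exact div_self hS.ne'
  have hmax : ∀ k, softmax W x k ≤ softmax W x s := fun k => by
    unfold softmax
    exact div_le_div_of_nonneg_right (Real.exp_le_exp.2 (hs k)) hS.le
  have hPs : P = softmax W x s := by
    rw [hP]
    exact le_antisymm (ciSup_le hmax) (le_ciSup (Set.finite_range _).bddAbove s)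
  have hPle : P ≤ 1 := by
    rw [hPs, ← hp1]
    exact Finset.single_le_sum (fun k _ => (hp0 k).le) (Finset.mem_univ s)
  set N := ∑ k, (softmax W x k - if k = y then 1 else 0) ^ 2 with hN
  have hN2 : N ≤ 2 * (1 - softmax W x y) ^ 2 := aux_sq _ (fun k => (hp0 k).le) hp1 y
  have hN0 : 0 ≤ N := Finset.sum_nonneg fun _ _ => sq_nonneg _
  have hM := aux_scalar K (softmax W x y) P
    ((1 - a) * (if s ≠ y then (1 : ℝ) else 0) + a * (((K : ℝ) - 1) / K)) (Real.log 2) N hK2 rfl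
    (hp0 y) hN2 (by
      by_cases h : (1 : ℝ) / 2 ≤ P
      · rw [if_pos h] at ha
        by_cases hsy : s = y
        · left
          refine ⟨h, by rw [hPs, hsy], hPle, ?_⟩
          simp [hsy, ha]
        · right; left
          refine ⟨h, ?_, ?_⟩
          · rw [hPs, add_comm]; exact aux_pair _ (fun k => (hp0 k).le) hp1 hsy
          · simp [hsy, ha]
      · rw [if_neg h] at ha
        right; right
        refine ⟨not_le.1 h, hPs ▸ hmax y, by simp [ha]⟩)
  have hC := aux_convex hK (fun k => ⟪U k, x⟫) (fun k => ⟪W k, x⟫) y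
  set G := ∑ k, (softmax W x k - if k = y then 1 else 0) * (⟪U k, x⟫ - ⟪W k, x⟫) with hG
  change - Real.log (softmax W x y) + G ≤ - Real.log (softmax U x y) at hC
  have hproj := aux_proj D hD (fun k => W k - η • g k) U hU
  rw [← hW'] at hproj
  have hexp : ∑ k, ‖W k - η • g k - U k‖ ^ 2 = ∑ k, ‖W k - U k‖ ^ 2
      + 2 * (η / Real.log 2) * G + (η / Real.log 2) ^ 2 * ‖x‖ ^ 2 * N := by
    rw [hG, hN, Finset.mul_sum, Finset.mul_sum, ← Finset.sum_add_distrib,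
      ← Finset.sum_add_distrib]
    refine Finset.sum_congr rfl fun k _ => ?_
    rw [hg]
    simp only
    generalize (softmax W x k - if k = y then (1:ℝ) else 0) = r
    have : W k - η • (1 / Real.log 2 * r) • x - U k
        = (W k - U k) - (η / Real.log 2 * r) • x := by
      rw [smul_smul, sub_right_comm]; congr 2; ring
    rw [this, norm_sub_sq_real, inner_smul_right, norm_smul, inner_sub_left, mul_pow,
      Real.norm_eq_abs, sq_abs]
    ring
  rw [hexp] at hproj
  have hx2 : ‖x‖ ^ 2 ≤ X ^ 2 := pow_le_pow_left₀ (norm_nonneg _) hx 2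
  have hηL : η / Real.log 2 = 1 / (2 * K * X ^ 2) := by rw [hη]; field_simp
  rw [hηL] at hproj
  have hK0 : (0:ℝ) < K := by linarith
  have hfin : - G / Real.log 2 - N / (4 * K * Real.log 2) ≤ K * X ^ 2 / Real.log 2 *
        (∑ k, ‖W k - U k‖ ^ 2 - ∑ k, ‖W' k - U k‖ ^ 2) := by
    have h1 : (1 / (2 * K * X ^ 2)) ^ 2 * ‖x‖ ^ 2 * N ≤ (1 / (2 * K * X ^ 2)) ^ 2 * X ^ 2 * N := by
      gcongr
    have h2 : - (2 * (1 / (2 * K * X ^ 2)) * G) - (1 / (2 * K * X ^ 2)) ^ 2 * X ^ 2 * N ≤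
      (∑ k, ‖W k - U k‖ ^ 2 - ∑ k, ‖W' k - U k‖ ^ 2) := by linarith
    have h3 := mul_le_mul_of_nonneg_left h2 (show 0 ≤ K * X ^ 2 / Real.log 2 by positivity)
    refine le_trans (le_of_eq ?_) h3
    field_simp
    ring
  have hC' := div_le_div_of_nonneg_right hC hL.le
  rw [add_div] at hC'
  have hlb : -(Real.logb 2 (softmax U x y)) = - Real.log (softmax U x y) / Real.log 2 := by
    rw [Real.logb, neg_div]
  rw [hlb]
  have : - G / Real.log 2 = - (G / Real.log 2) := neg_div _ _
  linarith

/-- Theorem 1: Gaptron mistake bound for the logistic loss (full information). -/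
theorem gaptron_logistic_full_info (K d T : ℕ) (hK : 2 ≤ K) (hd : 1 ≤ d)
    (X D : ℝ) (hX : 0 < X) (hD : 0 < D)
    (η : ℝ) (hη : η = Real.log 2 / (2 * K * X ^ 2))
    (x : Fin T → EuclideanSpace ℝ (Fin d)) (hx : ∀ t, ‖x t‖ ≤ X)
    (y : Fin T → Fin K)
    (W : ℕ → Fin K → EuclideanSpace ℝ (Fin d))
    (g : Fin T → Fin K → EuclideanSpace ℝ (Fin d))
    (hg : ∀ t : Fin T, g t = fun k =>
      ((1 / Real.log 2) * (softmax (W t.1) (x t) k - if k = y t then 1 else 0)) • x t)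
    (hW0 : W 0 = 0)
    (hWsucc : ∀ t : Fin T, W (t.1 + 1) = projM D (fun k => W t.1 k - η • g t k))
    (ystar : Fin T → Fin K)
    (hystar : ∀ t : Fin T, ∀ k, ⟪W t.1 k, x t⟫ ≤ ⟪W t.1 (ystar t), x t⟫)
    (pstar : Fin T → ℝ) (hpstar : ∀ t : Fin T, pstar t = ⨆ k, softmax (W t.1) (x t) k)
    (a : Fin T → ℝ)
    (ha : ∀ t, a t = if (1 : ℝ) / 2 ≤ pstar t then 1 - pstar t else 1)
    (U : Fin K → EuclideanSpace ℝ (Fin d)) (hU : frob U ≤ D) :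
    ∑ t : Fin T, ((1 - a t) * (if ystar t ≠ y t then (1 : ℝ) else 0)
        + a t * (((K : ℝ) - 1) / K))
      ≤ ∑ t : Fin T, (-(Real.logb 2 (softmax U (x t) (y t))))
        + K * X ^ 2 * frob U ^ 2 / Real.log 2 := by
  have h := Finset.sum_le_sum (fun (t : Fin T) (_ : t ∈ Finset.univ) =>
    aux_step hK X D hX hD η hη (x t) (hx t) (y t) (W t.1) (W (t.1 + 1)) (g t) (hg t)
      (hWsucc t) (ystar t) (hystar t) (pstar t) (hpstar t) (a t) (ha t) U hU)
  refine h.trans ?_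
  rw [Finset.sum_add_distrib, ← Finset.mul_sum]
  have hL : 0 < Real.log 2 := Real.log_pos (by norm_num)
  have e := Fin.sum_univ_eq_sum_range
    (fun t => ∑ k, ‖W t k - U k‖ ^ 2 - ∑ k, ‖W (t + 1) k - U k‖ ^ 2) T
  rw [e, Finset.sum_range_sub' (fun t => ∑ k, ‖W t k - U k‖ ^ 2)]
  have e0 : ∑ k, ‖W 0 k - U k‖ ^ 2 = frob U ^ 2 := by
    rw [hW0, frob_sq]; simp
  have hT : 0 ≤ ∑ k, ‖W T k - U k‖ ^ 2 := Finset.sum_nonneg fun _ _ => sq_nonneg _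
  rw [e0, mul_div_right_comm (_ * _) (frob U ^ 2)]
  gcongr
  linarith
end

section
/- Per-round surrogate gap bound for the bandit smooth multiclass hinge loss: Let K ≥ 2, d ≥ 1, X > 0, γ ∈ (0,1] and η = γ/(4K²X²). Let W ∈ ℝ^{K×d}, x ∈ ℝ^d with ‖x‖ ≤ X, y ∈ {1,…,K}, and p ∈ [γ/K, 1] (the probability with which the algorithm plays label y). Let y⋆ be any label maximizing k ↦ ⟨W^k,x⟩, k̃ any label maximizing k ↦ ⟨W^k,x⟩ over k ≠ y, m(y') = ⟨W^{y'},x⟩ − max_{k≠y'}⟨W^k,x⟩, m⋆ = max_k m(k), and a = (1 − min{1, m⋆})². Define ℓ(W) = max{1 − 2m(y), 0} if m(y) ≤ 0 and ℓ(W) = (1 − m(y))² if m(y) > 0; define g = 2(e_{k̃} − e_y) ⊗ x if y⋆ ≠ y, g = 2(1 − m⋆)(e_{k̃} − e_y) ⊗ x if y⋆ = y and m⋆ < 1, and g = 0 if y⋆ = y and m⋆ ≥ 1. Then (1 − a)·1[y⋆ ≠ y] + a·(K−1)/K − ℓ(W) + (η/(2p))‖g‖² ≤ 0. -/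
open scoped RealInnerProductSpace BigOperators

/-- Margin `m(W, x, y) = ⟨W^y, x⟩ − max_{k ≠ y} ⟨W^k, x⟩`. -/
noncomputable def margin {K d : ℕ} (W : Fin K → EuclideanSpace ℝ (Fin d))
    (x : EuclideanSpace ℝ (Fin d)) (y : Fin K) : ℝ :=
  ⟪W y, x⟫ - ⨆ k : {k : Fin K // k ≠ y}, ⟪W k.1, x⟫

lemma margin_le_aux {K d : ℕ} (W : Fin K → EuclideanSpace ℝ (Fin d))
    (x : EuclideanSpace ℝ (Fin d)) (y k : Fin K) (h : k ≠ y) :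
    margin W x y ≤ ⟪W y, x⟫ - ⟪W k, x⟫ := by
  unfold margin
  have := le_ciSup (f := fun k : {k : Fin K // k ≠ y} => ⟪W k.1, x⟫)
    (Set.finite_range _).bddAbove ⟨k, h⟩
  simp only at this
  linarith

lemma le_margin_aux {K d : ℕ} (W : Fin K → EuclideanSpace ℝ (Fin d))
    (x : EuclideanSpace ℝ (Fin d)) (y k : Fin K) (h : k ≠ y) (b : ℝ)
    (hb : ∀ j, j ≠ y → ⟪W j, x⟫ ≤ b) :
    ⟪W y, x⟫ - b ≤ margin W x y := by
  unfold margin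
  haveI : Nonempty {k : Fin K // k ≠ y} := ⟨⟨k, h⟩⟩
  have := ciSup_le (f := fun k : {k : Fin K // k ≠ y} => ⟪W k.1, x⟫) (c := b)
    (fun j => hb j.1 j.2)
  linarith

lemma frob_aux {K d : ℕ} (x : EuclideanSpace ℝ (Fin d)) (y k : Fin K) (h : k ≠ y) (c : ℝ) :
    frob (fun j : Fin K => (c * ((if j = k then (1 : ℝ) else 0) - if j = y then 1 else 0)) • x) ^ 2
      = c ^ 2 * (2 * ‖x‖ ^ 2) := by
  unfold frob
  rw [Real.sq_sqrt (Finset.sum_nonneg fun _ _ => by positivity)]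
  have : ∀ j : Fin K, ‖(c * ((if j = k then (1 : ℝ) else 0) - if j = y then 1 else 0)) • x‖ ^ 2
      = (if j = k then c ^ 2 * ‖x‖ ^ 2 else 0) + (if j = y then c ^ 2 * ‖x‖ ^ 2 else 0) := by
    intro j
    rw [norm_smul, mul_pow, Real.norm_eq_abs, sq_abs]
    by_cases h1 : j = k
    · subst h1
      simp [h]
    · by_cases h2 : j = y <;> simp [h1, h2, Ne.symm h]
  simp only [this, Finset.sum_add_distrib, Finset.sum_ite_eq', Finset.mem_univ, if_true]
  ring

/-- Per-round surrogate gap bound for the bandit smooth multiclass hinge loss. -/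
theorem gaptron_bandit_smooth_hinge_gap (K d : ℕ) (hK : 2 ≤ K) (hd : 1 ≤ d)
    (X : ℝ) (hX : 0 < X)
    (γ : ℝ) (hγ : 0 < γ ∧ γ ≤ 1)
    (η : ℝ) (hη : η = γ / (4 * K ^ 2 * X ^ 2))
    (W : Fin K → EuclideanSpace ℝ (Fin d))
    (x : EuclideanSpace ℝ (Fin d)) (hx : ‖x‖ ≤ X)
    (y ystar ktil : Fin K)
    (p : ℝ) (hp : p ∈ Set.Icc (γ / K) 1)
    (hystar : ∀ k, ⟪W k, x⟫ ≤ ⟪W ystar, x⟫)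
    (hktil : ktil ≠ y ∧ ∀ k, k ≠ y → ⟪W k, x⟫ ≤ ⟪W ktil, x⟫)
    (mstar : ℝ) (hmstar : mstar = ⨆ k, margin W x k)
    (a : ℝ) (ha : a = (1 - min 1 mstar) ^ 2)
    (ℓW : ℝ)
    (hℓ : ℓW = if margin W x y ≤ 0 then max (1 - 2 * margin W x y) 0
      else (1 - margin W x y) ^ 2)
    (g : Fin K → EuclideanSpace ℝ (Fin d))
    (hg : g =
      if ystar ≠ y then
        (fun k => (2 * ((if k = ktil then (1 : ℝ) else 0) - if k = y then 1 else 0)) • x)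
      else if mstar < 1 then
        (fun k => (2 * (1 - mstar) *
          ((if k = ktil then (1 : ℝ) else 0) - if k = y then 1 else 0)) • x)
      else 0) :
    (1 - a) * (if ystar ≠ y then (1 : ℝ) else 0) + a * (((K : ℝ) - 1) / K)
      - ℓW + (η / (2 * p)) * frob g ^ 2 ≤ 0 := by
  obtain ⟨hγ0, hγ1⟩ := hγ
  obtain ⟨hp0, hp1⟩ := hp
  obtain ⟨hky, hk⟩ := hktil
  have hK2 : (2 : ℝ) ≤ K := by exact_mod_cast hK
  have hK0 : (0 : ℝ) < K := by linarith
  have hpp : 0 < p := lt_of_lt_of_le (by positivity) hp0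
  have hstep : η / (2 * p) * (2 * ‖x‖ ^ 2) ≤ 1 / (4 * K) := by
    have h1 : η * ‖x‖ ^ 2 ≤ γ / K / (4 * K) := by
      have hη0 : 0 ≤ η := by rw [hη]; positivity
      calc η * ‖x‖ ^ 2 ≤ η * X ^ 2 := by gcongr
        _ = γ / K / (4 * K) := by rw [hη]; field_simp
    have h2 : γ / K / (4 * K) ≤ p / (4 * K) := by gcongr
    calc η / (2 * p) * (2 * ‖x‖ ^ 2) = (η * ‖x‖ ^ 2) / p := by field_simp
      _ ≤ (p / (4 * K)) / p := by gcongr; linarith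
      _ = 1 / (4 * K) := by field_simp
  have hterm : ∀ c : ℝ, η / (2 * p) * (c ^ 2 * (2 * ‖x‖ ^ 2)) ≤ c ^ 2 * (1 / (4 * K)) := by
    intro c
    have := mul_le_mul_of_nonneg_left hstep (sq_nonneg c)
    linarith
  have hother : ∃ j, j ≠ ystar := by
    by_cases h : y = ystar
    · exact ⟨ktil, h ▸ hky⟩
    · exact ⟨y, h⟩
  obtain ⟨j, hj⟩ := hother
  have hms0 : 0 ≤ margin W x ystar := by
    have := le_margin_aux W x ystar j hj _ (fun j _ => hystar j)
    linarith
  have hms : mstar = margin W x ystar := by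
    rw [hmstar]
    haveI : Nonempty (Fin K) := ⟨y⟩
    apply le_antisymm
    · apply ciSup_le
      intro k
      by_cases h : k = ystar
      · rw [h]
      · have := margin_le_aux W x k ystar (Ne.symm h)
        have := hystar k
        linarith
    · exact le_ciSup (f := fun k => margin W x k) (Set.finite_range _).bddAbove ystar
  have hr : ((K : ℝ) - 1) / K = 1 - 1 / K := by field_simp
  have hi : (1 : ℝ) / (4 * K) = 1 / K / 4 := by field_simp
  have hi0 : (0 : ℝ) < 1 / K := by positivity
  have hi1 : (1 : ℝ) / K ≤ 1 := by rw [div_le_one hK0]; linarith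
  rw [hi] at hterm
  rw [hr]
  generalize (1 : ℝ) / K = q at *
  by_cases hy : ystar = y
  · subst hy
    rw [← hms] at hℓ hms0
    simp only [ne_eq, not_true_eq_false, if_false] at hg ⊢
    by_cases hm : mstar < 1
    · rw [if_pos hm] at hg
      rw [hg, frob_aux x ystar ktil hky]
      have hl : ℓW = (1 - mstar) ^ 2 := by
        rw [hℓ]
        split_ifs with h
        · have : mstar = 0 := le_antisymm h hms0
          rw [this]; norm_num
        · rfl
      rw [min_eq_right hm.le] at ha
      have := hterm (2 * (1 - mstar))
      rw [hl, ha]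
      nlinarith
    · rw [if_neg hm] at hg
      rw [min_eq_left (not_lt.mp hm)] at ha
      have hl : 0 ≤ ℓW := by
        rw [hℓ]
        split_ifs
        · exact le_max_right _ _
        · positivity
      have hf : frob g ^ 2 = 0 := by
        rw [hg]; simp [frob]
      rw [hf, ha]
      linarith
  · simp only [ne_eq, hy, not_false_eq_true, if_true] at hg ⊢
    rw [hg, frob_aux x y ktil hky]
    have h1 := margin_le_aux W x y ystar hy
    have h2 := margin_le_aux W x ystar y (Ne.symm hy)
    have h3 := hystar y
    rw [← hms] at h2 hms0
    have h4 : margin W x y ≤ 0 := by linarith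
    rw [if_pos h4] at hℓ
    have h5 : 1 - 2 * margin W x y ≤ ℓW := hℓ ▸ le_max_left _ _
    have h6 := hterm 2
    have h7 : min 1 mstar ≤ mstar := min_le_right _ _
    have h8 : 0 ≤ min 1 mstar := le_min zero_le_one hms0
    generalize min 1 mstar = u at *
    have h9 : 1 - a ≤ 2 * u := by rw [ha]; nlinarith
    have h10 : (1 - a) * q ≤ 2 * u * q := by gcongr
    have h11 : u * q ≤ u := mul_le_of_le_one_right h8 hi1
    nlinarith
end
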